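/- arXiv:math/0506365 — 2 statements merged into one kernel-verified Lean document; each statement's English description precedes it below -/
import Mathlib

section
/- For n > p (i.e. k ≥ 2), the radical R₁ = {a ∈ 𝒢_{n,p}(𝕂) : α₁([a,b]) = 0 for all b} of δα₁, where α₁(x,u) = tr(x·H₀), equals {(0,u) : u ∈ gl(n,𝕂), H₀·u = 0}, and it is isomorphic as a Lie algebra to 𝒢_{n−p,p}(𝕂). Explicitly, H₀·u = 0 if and only if u has block form u = [[u₁, w],[0, 0]] with u₁ ∈ gl(n−p,𝕂) and w ∈ M_{n−p,p}(𝕂), and the map (0,u) ↦ (w, u₁) is a Lie algebra isomorphism from R₁ onto 𝒢_{n−p,p}(𝕂). -/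
open Matrix

/-- The underlying space of the Lie algebra `𝒢_{m,p}(𝕂) = M_{m,p}(𝕂) × gl(m,𝕂)`. -/
abbrev GA (𝕂 : Type) [RCLike 𝕂] (m p : ℕ) : Type :=
  Matrix (Fin m) (Fin p) 𝕂 × Matrix (Fin m) (Fin m) 𝕂

/-- The Lie bracket `[(x,u),(y,v)] = (u·y − v·x, u·v − v·u)` of `𝒢_{m,p}(𝕂)`. -/
def bkt {𝕂 : Type} [RCLike 𝕂] {m p : ℕ} (a b : GA 𝕂 m p) : GA 𝕂 m p :=
  (a.2 * b.1 - b.2 * a.1, a.2 * b.2 - b.2 * a.2)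

/-- The block row `H₀ = (0,…,0,I_p) ∈ M_{p,n}(𝕂)`. -/
def H0 (𝕂 : Type) [RCLike 𝕂] (n p : ℕ) : Matrix (Fin p) (Fin n) 𝕂 :=
  Matrix.of fun i j => if (j : ℕ) = n - p + (i : ℕ) then 1 else 0

/-- The map `u ↦ (w, u₁)` sending `u = [[u₁,w],[0,0]]` to the pair of its first block row,
realizing the isomorphism of `R₁ = {(0,u) : H₀·u = 0}` with `𝒢_{n−p,p}(𝕂)`. -/
def phi {𝕂 : Type} [RCLike 𝕂] {m p : ℕ}
    (u : Matrix (Fin (m + p)) (Fin (m + p)) 𝕂) : GA 𝕂 m p :=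
  (Matrix.toBlocks₁₂ ((Matrix.reindex finSumFinEquiv finSumFinEquiv).symm u),
   Matrix.toBlocks₁₁ ((Matrix.reindex finSumFinEquiv finSumFinEquiv).symm u))

theorem H0_mul_apply {𝕂 : Type} [RCLike 𝕂] {m p q : ℕ} (u : Matrix (Fin (m + p)) (Fin q) 𝕂)
    (i : Fin p) (j : Fin q) : (H0 𝕂 (m + p) p * u) i j = u (Fin.natAdd m i) j := by
  rw [Matrix.mul_apply, Finset.sum_eq_single (Fin.natAdd m i)]
  · simp [H0]
  · intro b _ hb
    have : (b : ℕ) ≠ m + p - p + (i : ℕ) := by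
      intro h; apply hb; ext; simp; omega
    simp only [H0, Matrix.of_apply, if_neg this, zero_mul]
  · simp

theorem mul_H0_apply {𝕂 : Type} [RCLike 𝕂] {m p q : ℕ} (x : Matrix (Fin q) (Fin p) 𝕂)
    (i : Fin q) (j : Fin p) : (x * H0 𝕂 (m + p) p) i (Fin.natAdd m j) = x i j := by
  rw [Matrix.mul_apply, Finset.sum_eq_single j]
  · simp [H0]
  · intro b _ hb
    have : ((Fin.natAdd m j : Fin (m + p)) : ℕ) ≠ m + p - p + (b : ℕ) := by
      intro h; apply hb; ext; simp at h; omega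
    simp only [H0, Matrix.of_apply, if_neg this, mul_zero]
  · simp

theorem H0_mul_zero_iff {𝕂 : Type} [RCLike 𝕂] {m p q : ℕ} (u : Matrix (Fin (m + p)) (Fin q) 𝕂) :
    H0 𝕂 (m + p) p * u = 0 ↔ ∀ i j, u (Fin.natAdd m i) j = 0 := by
  constructor
  · intro h i j
    rw [← H0_mul_apply u i j, h]; rfl
  · intro h
    ext i j
    rw [H0_mul_apply, h]; rfl

theorem eq_zero_of_tr {𝕂 : Type} [RCLike 𝕂] {a b : ℕ} (M : Matrix (Fin a) (Fin b) 𝕂)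
    (h : ∀ x : Matrix (Fin b) (Fin a) 𝕂, trace (M * x) = 0) : M = 0 := by
  ext i j
  have := h (Matrix.single j i 1)
  simpa [Matrix.trace_mul_single] using this

theorem block_iff {𝕂 : Type} [RCLike 𝕂] {m p : ℕ} (u : Matrix (Fin (m + p)) (Fin (m + p)) 𝕂) :
    H0 𝕂 (m + p) p * u = 0 ↔
        ∃ (u₁ : Matrix (Fin m) (Fin m) 𝕂) (w : Matrix (Fin m) (Fin p) 𝕂),
          u = Matrix.reindex finSumFinEquiv finSumFinEquiv (Matrix.fromBlocks u₁ w 0 0) := by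
  rw [H0_mul_zero_iff]
  constructor
  · intro h
    refine ⟨(phi u).2, (phi u).1, ?_⟩
    rw [← Equiv.symm_apply_eq]
    ext i j
    rcases i with i | i <;> rcases j with j | j <;>
      simp [phi, Matrix.toBlocks₁₁, Matrix.toBlocks₁₂, h]
  · rintro ⟨u₁, w, rfl⟩ i j
    induction j using Fin.addCases <;> simp

theorem phi_block {𝕂 : Type} [RCLike 𝕂] {m p : ℕ} (u₁ : Matrix (Fin m) (Fin m) 𝕂)
    (w : Matrix (Fin m) (Fin p) 𝕂) :
    phi (Matrix.reindex finSumFinEquiv finSumFinEquiv (Matrix.fromBlocks u₁ w 0 0)) = (w, u₁) := by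
  unfold phi
  rw [Equiv.symm_apply_apply]; simp

/-- For `n = m + p > p` (with `m = (k−1)p`, `k ≥ 2`), the radical
`R₁ = Rad(δα₁)` of `δα₁`, where `α₁(x,u) = tr(x·H₀)`, equals `{(0,u) : H₀·u = 0}`;
`H₀·u = 0` holds iff `u` has block form `[[u₁,w],[0,0]]`; and `(0,u) ↦ (w,u₁)` is a Lie
algebra isomorphism of `R₁` onto `𝒢_{n−p,p}(𝕂)`. -/
theorem stmt8 (𝕂 : Type) [RCLike 𝕂] (p k m : ℕ) (hp : 1 ≤ p) (hk : 2 ≤ k)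
    (hm : m = (k - 1) * p) :
    -- R₁ = {(0,u) : H₀·u = 0}
    (∀ a : GA 𝕂 (m + p) p,
      (∀ b : GA 𝕂 (m + p) p, trace ((bkt a b).1 * H0 𝕂 (m + p) p) = 0) ↔
        (a.1 = 0 ∧ H0 𝕂 (m + p) p * a.2 = 0)) ∧
    -- block description of {u : H₀·u = 0}
    (∀ u : Matrix (Fin (m + p)) (Fin (m + p)) 𝕂,
      H0 𝕂 (m + p) p * u = 0 ↔
        ∃ (u₁ : Matrix (Fin m) (Fin m) 𝕂) (w : Matrix (Fin m) (Fin p) 𝕂),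
          u = Matrix.reindex finSumFinEquiv finSumFinEquiv (Matrix.fromBlocks u₁ w 0 0)) ∧
    -- φ : (0,u) ↦ (w,u₁) is a Lie algebra isomorphism onto 𝒢_{m,p}(𝕂):
    -- linearity
    (∀ u v : Matrix (Fin (m + p)) (Fin (m + p)) 𝕂, phi (u + v) = phi u + phi v) ∧
    (∀ (c : 𝕂) (u : Matrix (Fin (m + p)) (Fin (m + p)) 𝕂), phi (c • u) = c • phi u) ∧
    -- injectivity on R₁
    (∀ u v : Matrix (Fin (m + p)) (Fin (m + p)) 𝕂,
      H0 𝕂 (m + p) p * u = 0 → H0 𝕂 (m + p) p * v = 0 →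
        (phi u : GA 𝕂 m p) = phi v → u = v) ∧
    -- surjectivity onto 𝒢_{m,p}(𝕂)
    (∀ g : GA 𝕂 m p, ∃ u : Matrix (Fin (m + p)) (Fin (m + p)) 𝕂,
      H0 𝕂 (m + p) p * u = 0 ∧ phi u = g) ∧
    -- bracket compatibility ([(0,u),(0,v)] = (0, u·v − v·u))
    (∀ u v : Matrix (Fin (m + p)) (Fin (m + p)) 𝕂,
      H0 𝕂 (m + p) p * u = 0 → H0 𝕂 (m + p) p * v = 0 →
        phi (u * v - v * u) = bkt (phi u) (phi v)) := by
  refine ⟨?_, block_iff, fun u v => rfl, fun c u => rfl, ?_, ?_, ?_⟩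
  · rintro ⟨x, u⟩
    constructor
    · intro h
      constructor
      · have h0 : x * H0 𝕂 (m + p) p = 0 := by
          apply eq_zero_of_tr
          intro v
          have := h (0, v)
          simp only [bkt, Matrix.mul_zero, zero_sub, Matrix.neg_mul, trace_neg, neg_eq_zero] at this
          rw [trace_mul_comm, ← Matrix.mul_assoc]; exact this
        ext i j
        change x i j = 0
        rw [← mul_H0_apply (m := m) x, h0]; rfl
      · apply eq_zero_of_tr
        intro y
        have := h (y, 0)
        simp only [bkt, Matrix.zero_mul, sub_zero] at this
        rw [Matrix.mul_assoc, trace_mul_comm]; exact this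
    · rintro ⟨h1, h2⟩ ⟨y, v⟩
      simp only at h1 h2
      subst h1
      simp only [bkt, Matrix.mul_zero, sub_zero]
      rw [trace_mul_comm, ← Matrix.mul_assoc, h2]; simp
  · intro u v hu hv h
    obtain ⟨a, b, rfl⟩ := (block_iff u).1 hu
    obtain ⟨c, d, rfl⟩ := (block_iff v).1 hv
    rw [phi_block, phi_block, Prod.mk.injEq] at h
    rw [h.1, h.2]
  · rintro ⟨w, u₁⟩
    exact ⟨_, (block_iff _).2 ⟨u₁, w, rfl⟩, phi_block u₁ w⟩
  · intro u v hu hv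
    obtain ⟨a, b, rfl⟩ := (block_iff u).1 hu
    obtain ⟨c, d, rfl⟩ := (block_iff v).1 hv
    have e : ∀ (a c : Matrix (Fin m) (Fin m) 𝕂) (b d : Matrix (Fin m) (Fin p) 𝕂),
        Matrix.reindex finSumFinEquiv finSumFinEquiv (Matrix.fromBlocks a b 0 0) *
        Matrix.reindex finSumFinEquiv finSumFinEquiv (Matrix.fromBlocks c d 0 0) =
        (Matrix.reindex finSumFinEquiv finSumFinEquiv
          (Matrix.fromBlocks (a * c) (a * d) 0 0) : Matrix (Fin (m + p)) (Fin (m + p)) 𝕂) := by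
      intro a c b d
      simp only [Matrix.reindex_apply, Matrix.submatrix_mul_equiv, Matrix.fromBlocks_multiply]
      simp
    have hs : ∀ u v : Matrix (Fin (m + p)) (Fin (m + p)) 𝕂,
        (phi (u - v) : GA 𝕂 m p) = phi u - phi v := fun u v => rfl
    rw [hs, e, e]
    simp only [phi_block]
    rfl
end

section
/- Let n > p (i.e. k ≥ 2) and let i : 𝕂^{n−p} → 𝕂^n, Z : 𝕂^p → 𝕂^n, r : 𝕂^n → 𝕂^{n−p} and H : 𝕂^n → 𝕂^p be linear maps satisfying r∘i = id, r∘Z = 0, H∘i = 0 and H∘Z = id. Define η : M_{n−p,p}(𝕂) × gl(n−p,𝕂) → gl(n,𝕂) by η(x,u) = i∘u∘r + (i∘x)∘H. Then η is an injective Lie algebra homomorphism from 𝒢_{n−p,p}(𝕂) into gl(n,𝕂), and for all (H₁,N₁) ∈ M_{p,n−p}(𝕂) × gl(n−p,𝕂) and all (x,u) ∈ 𝒢_{n−p,p}(𝕂) one has the identity tr(H₁·x) + tr(N₁·u) = tr(R(H₁,N₁)·η(x,u)), where R(H₁,N₁) = i∘N₁∘r + Z∘(H₁∘r) ∈ gl(n,𝕂).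 -/
open Matrix

/-- With `n = m + p` (`m = (k−1)p`, `k ≥ 2`) and linear maps
`i : 𝕂^{n−p} → 𝕂^n`, `Z : 𝕂^p → 𝕂^n`, `r : 𝕂^n → 𝕂^{n−p}`, `H : 𝕂^n → 𝕂^p` with
`r∘i = id`, `r∘Z = 0`, `H∘i = 0`, `H∘Z = id`, the map
`η(x,u) = i∘u∘r + (i∘x)∘H` is an injective Lie algebra homomorphism
`𝒢_{n−p,p}(𝕂) → gl(n,𝕂)`, and `tr(H₁·x) + tr(N₁·u) = tr(R(H₁,N₁)·η(x,u))` where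
`R(H₁,N₁) = i∘N₁∘r + Z∘(H₁∘r)`. -/
theorem stmt19 (𝕂 : Type) [RCLike 𝕂] (p k m : ℕ) (hp : 1 ≤ p) (hk : 2 ≤ k)
    (hm : m = (k - 1) * p)
    (i : (Fin m → 𝕂) →ₗ[𝕂] (Fin (m + p) → 𝕂))
    (Z : (Fin p → 𝕂) →ₗ[𝕂] (Fin (m + p) → 𝕂))
    (r : (Fin (m + p) → 𝕂) →ₗ[𝕂] (Fin m → 𝕂))
    (H : (Fin (m + p) → 𝕂) →ₗ[𝕂] (Fin p → 𝕂))
    (hri : r ∘ₗ i = LinearMap.id) (hrZ : r ∘ₗ Z = 0)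
    (hHi : H ∘ₗ i = 0) (hHZ : H ∘ₗ Z = LinearMap.id) :
    let η : GA 𝕂 m p → Module.End 𝕂 (Fin (m + p) → 𝕂) := fun a =>
      i ∘ₗ Matrix.mulVecLin a.2 ∘ₗ r + (i ∘ₗ Matrix.mulVecLin a.1) ∘ₗ H
    -- η is linear …
    (∀ a b : GA 𝕂 m p, η (a + b) = η a + η b) ∧
    (∀ (c : 𝕂) (a : GA 𝕂 m p), η (c • a) = c • η a) ∧
    -- … injective …
    Function.Injective η ∧
    -- … and a Lie algebra homomorphism into gl(n,𝕂)
    (∀ a b : GA 𝕂 m p, η (bkt a b) = η a ∘ₗ η b - η b ∘ₗ η a) ∧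
    -- trace identity: tr(H₁·x) + tr(N₁·u) = tr(R(H₁,N₁)·η(x,u))
    (∀ (H₁ : Matrix (Fin p) (Fin m) 𝕂) (N₁ : Matrix (Fin m) (Fin m) 𝕂) (a : GA 𝕂 m p),
      trace (H₁ * a.1) + trace (N₁ * a.2)
        = LinearMap.trace 𝕂 (Fin (m + p) → 𝕂)
            ((i ∘ₗ Matrix.mulVecLin N₁ ∘ₗ r + Z ∘ₗ (Matrix.mulVecLin H₁ ∘ₗ r)) ∘ₗ η a)) := by
  have ri : ∀ v, r (i v) = v := fun v => LinearMap.congr_fun hri v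
  have rZ : ∀ v, r (Z v) = 0 := fun v => LinearMap.congr_fun hrZ v
  have Hi : ∀ v, H (i v) = 0 := fun v => LinearMap.congr_fun hHi v
  have HZ : ∀ v, H (Z v) = v := fun v => LinearMap.congr_fun hHZ v
  intro η
  have hη : ∀ a v, η a v = i (a.2 *ᵥ r v) + i (a.1 *ᵥ H v) := fun a v => rfl
  refine ⟨?_, ?_, ?_, ?_, ?_⟩
  · intro a b
    refine LinearMap.ext fun v => ?_
    simp only [LinearMap.add_apply, hη, Prod.fst_add, Prod.snd_add, Matrix.add_mulVec, map_add]
    abel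
  · intro c a
    refine LinearMap.ext fun v => ?_
    simp only [LinearMap.smul_apply, hη, Prod.smul_fst, Prod.smul_snd, Matrix.smul_mulVec, map_smul,
      smul_add]
  · intro a b hab
    have key : ∀ v, r (η a v) = r (η b v) := fun v => by rw [hab]
    simp only [hη, map_add, ri] at key
    refine Prod.ext ?_ ?_
    · refine Matrix.mulVec_injective (funext fun v => ?_)
      simpa [rZ, HZ] using key (Z v)
    · refine Matrix.mulVec_injective (funext fun v => ?_)
      simpa [ri, Hi] using key (i v)
  · intro a b
    refine LinearMap.ext fun v => ?_
    simp only [LinearMap.sub_apply, LinearMap.comp_apply, hη, bkt, Matrix.sub_mulVec, map_add,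
      map_sub, ri, Hi, Matrix.mulVec_add, Matrix.mulVec_zero, map_zero, ← Matrix.mulVec_mulVec]
    abel
  · intro H₁ N₁ a
    have e : (i ∘ₗ Matrix.mulVecLin N₁ ∘ₗ r + Z ∘ₗ (Matrix.mulVecLin H₁ ∘ₗ r)) ∘ₗ η a
        = i ∘ₗ (Matrix.mulVecLin (N₁ * a.2) ∘ₗ r + Matrix.mulVecLin (N₁ * a.1) ∘ₗ H)
          + Z ∘ₗ (Matrix.mulVecLin (H₁ * a.2) ∘ₗ r + Matrix.mulVecLin (H₁ * a.1) ∘ₗ H) := by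
      refine LinearMap.ext fun v => ?_
      simp only [LinearMap.add_apply, LinearMap.comp_apply, hη, map_add, ri,
        Matrix.mulVecLin_apply, Matrix.mulVec_mulVec]
      abel
    rw [e, map_add, LinearMap.trace_comp_comm' _ i, LinearMap.trace_comp_comm' _ Z]
    have t : ∀ (q : ℕ) (A : Matrix (Fin q) (Fin q) 𝕂),
        LinearMap.trace 𝕂 (Fin q → 𝕂) A.mulVecLin = A.trace := fun q A =>
      Matrix.trace_toLin'_eq A
    rw [LinearMap.add_comp, LinearMap.add_comp, LinearMap.comp_assoc, LinearMap.comp_assoc,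
      LinearMap.comp_assoc, LinearMap.comp_assoc, hri, hrZ, hHi, hHZ]
    simp only [LinearMap.comp_id, LinearMap.comp_zero, add_zero, zero_add, t]
    exact add_comm _ _
end
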